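/- Let p be a prime and let G be a finite nonabelian p-group that is an F-group, meaning that for all x, y ∈ G \ Z(G), C_G(x) ⊆ C_G(y) implies C_G(x) = C_G(y). Then for every g ∈ G \ Z(G): (1) the number of distinct non-central element centers contained in C_G(g), i.e. the cardinality of { Z : ∃ x ∈ G \ Z(G), Z = Z(x) and Z ⊆ C_G(g) }, is congruent to 1 modulo p; and (2) the number of distinct non-central element centers contained in C_G(g) and different from Z(g) is congruent to 0 modulo p. -/

import Mathlib

/-- In a finite `p`-group, a proper inclusion of subgroups multiplies the order by a multiple
of `p`. -/
theorem IsPGroup.card_mul_dvd_card_of_lt {p : ℕ} [Fact p.Prime] {G : Type*} [Group G] [Finite G]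
    (hG : IsPGroup p G) {H K : Subgroup G} (h : H < K) : Nat.card H * p ∣ Nat.card K := by
  obtain ⟨n, hn⟩ := (hG.to_subgroup K).index (H.subgroupOf K)
  have hn0 : n ≠ 0 := by
    rintro rfl
    exact h.not_ge (Subgroup.relIndex_eq_one.mp (by simpa using hn))
  rw [← Subgroup.relIndex_bot_left K, ← Subgroup.relIndex_mul_relIndex ⊥ H K bot_le h.le,
    Subgroup.relIndex_bot_left]
  exact mul_dvd_mul_left _ ((dvd_pow_self p hn0).trans (dvd_of_eq hn.symm))

/-- The number of elements of `K` outside a proper subgroup `H` is `-|H|` modulo `|H| * p`. -/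
theorem IsPGroup.card_mul_dvd_ncard_diff_add {p : ℕ} [Fact p.Prime] {G : Type*} [Group G]
    [Finite G] (hG : IsPGroup p G) {H K : Subgroup G} (h : H < K) :
    Nat.card H * p ∣ ((K : Set G) \ H).ncard + Nat.card H := by
  have := Set.ncard_sdiff_add_ncard_of_subset (SetLike.coe_subset_coe.mpr h.le) (Set.toFinite _)
  rw [← Nat.card_coe_set_eq (H : Set G), ← Nat.card_coe_set_eq (K : Set G)] at this
  exact this ▸ hG.card_mul_dvd_card_of_lt h

/-- A centralizer containing a noncentral element is strictly larger than the center. -/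
theorem Subgroup.center_lt_centralizer {G : Type*} [Group G] (S : Set G) {x : G}
    (hx : x ∉ center G) (hxS : x ∈ centralizer S) : center G < centralizer S :=
  lt_of_le_of_ne (center_le_centralizer S) fun h => hx (h ▸ hxS)

/-- The element center of `x` is contained in the centralizer of `g` exactly when `x` is. -/
theorem Set.centralizer_centralizer_singleton_subset_iff {G : Type*} [Group G] {x g : G} :
    centralizer (centralizer {x}) ⊆ centralizer ({g} : Set G) ↔
      x ∈ centralizer ({g} : Set G) := by
  refine ⟨fun h => h (subset_centralizer_centralizer rfl), fun h => centralizer_subset ?_⟩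
  rw [singleton_subset_iff]
  simpa [mem_centralizer_iff, eq_comm] using h

/-- In an F-group, the noncentral elements whose element center is that of `x` are the noncentral
elements of the element center of `x`. -/
theorem Set.centralizer_centralizer_eq_iff_mem {G : Type*} [Group G]
    (hF : ∀ x y : G, x ∉ Subgroup.center G → y ∉ Subgroup.center G →
      centralizer ({x} : Set G) ⊆ centralizer {y} →
      centralizer ({x} : Set G) = centralizer {y})
    {x y : G} (hx : x ∉ Subgroup.center G) (hy : y ∉ Subgroup.center G) :
    centralizer (centralizer {y}) = centralizer (centralizer ({x} : Set G)) ↔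
      y ∈ centralizer (centralizer ({x} : Set G)) := by
  refine ⟨fun h => h ▸ subset_centralizer_centralizer rfl, fun h => ?_⟩
  rw [hF x y hx hy fun z hz => ?_]
  simpa [mem_centralizer_iff, eq_comm] using h z hz

/-- In a finite F-group of `p`-power order, the number of noncentral element centers contained in
the centralizer of a noncentral element is `1` modulo `p`: these centers partition the noncentral
elements of the centralizer. -/
theorem card_elementCenters_modEq_one {p : ℕ} [Fact p.Prime] {G : Type*} [Group G] [Finite G]
    (hG : IsPGroup p G)
    (hF : ∀ x y : G, x ∉ Subgroup.center G → y ∉ Subgroup.center G →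
      Set.centralizer ({x} : Set G) ⊆ Set.centralizer {y} →
      Set.centralizer ({x} : Set G) = Set.centralizer {y})
    {g : G} (hg : g ∉ Subgroup.center G) :
    {Z : Set G | (∃ x : G, x ∉ Subgroup.center G ∧
        Z = Set.centralizer (Set.centralizer {x})) ∧
        Z ⊆ Set.centralizer {g}}.ncard ≡ 1 [MOD p] := by
  classical
  cases nonempty_fintype G
  let f : G → Set G := fun x => Set.centralizer (Set.centralizer {x})
  let N : Finset G := (Set.centralizer {g} \ (Subgroup.center G : Set G)).toFinset
  let c := Nat.card (Subgroup.center G)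
  have hc : c ≠ 0 := Nat.card_pos.ne'
  have hset : {Z : Set G | (∃ x : G, x ∉ Subgroup.center G ∧
      Z = Set.centralizer (Set.centralizer {x})) ∧ Z ⊆ Set.centralizer {g}} =
      (N.image f : Finset (Set G)) := by
    ext Z
    simp only [Set.mem_ofPred_eq, Finset.coe_image, Set.mem_image, N, Set.coe_toFinset]
    constructor
    · rintro ⟨⟨x, hx, rfl⟩, hxg⟩
      exact ⟨x, ⟨Set.centralizer_centralizer_singleton_subset_iff.mp hxg, hx⟩, rfl⟩
    · rintro ⟨x, ⟨hxg, hx⟩, rfl⟩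
      exact ⟨⟨x, hx, rfl⟩, Set.centralizer_centralizer_singleton_subset_iff.mpr hxg⟩
  have hN : c * p ∣ N.card + c := by
    rw [← Set.ncard_eq_toFinset_card']
    exact hG.card_mul_dvd_ncard_diff_add
      (Subgroup.center_lt_centralizer {g} hg fun z hz => by rw [Set.mem_singleton_iff.mp hz])
  have hfiber : ∀ Z ∈ N.image f, c * p ∣ (N.filter (f · = Z)).card + c := by
    intro Z hZ
    obtain ⟨x, hxN, rfl⟩ := Finset.mem_image.mp hZ
    obtain ⟨hxg, hx⟩ := Set.mem_toFinset.mp hxN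
    have heq : ((N.filter (f · = f x) : Finset G) : Set G) =
        f x \ (Subgroup.center G : Set G) := by
      ext y
      simp only [Finset.coe_filter, Set.mem_ofPred_eq, N, Set.mem_toFinset, Set.mem_sdiff,
        SetLike.mem_coe]
      constructor
      · rintro ⟨⟨-, hy⟩, hyx⟩
        exact ⟨(Set.centralizer_centralizer_eq_iff_mem hF hx hy).mp hyx, hy⟩
      · rintro ⟨hyx, hy⟩
        exact ⟨⟨Set.centralizer_centralizer_singleton_subset_iff.mpr hxg hyx, hy⟩,
          (Set.centralizer_centralizer_eq_iff_mem hF hx hy).mpr hyx⟩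
    rw [← Set.ncard_coe_finset, heq]
    exact hG.card_mul_dvd_ncard_diff_add
      (Subgroup.center_lt_centralizer (Set.centralizer {x}) hx
        (Set.subset_centralizer_centralizer rfl))
  have hsum : c * p ∣ N.card + (N.image f).card * c := by
    rw [Finset.card_eq_sum_card_image f N, ← smul_eq_mul (_ : ℕ) c, ← Finset.sum_const,
      ← Finset.sum_add_distrib]
    exact Finset.dvd_sum hfiber
  rw [hset, Set.ncard_coe_finset]
  have hmod : (N.image f).card * c ≡ 1 * c [MOD p * c] := by
    rw [one_mul, mul_comm p c]
    exact Nat.ModEq.add_left_cancel' N.card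
      ((Nat.modEq_zero_iff_dvd.mpr hsum).trans (Nat.modEq_zero_iff_dvd.mpr hN).symm)
  exact Nat.ModEq.mul_right_cancel' hc hmod

theorem F_group_element_center_counts
    (p : ℕ) (hp : p.Prime) (G : Type*) [Group G] [Fintype G] (hG : IsPGroup p G)
    (hna : ∃ a b : G, a * b ≠ b * a)
    (hF : ∀ x y : G, x ∉ Subgroup.center G → y ∉ Subgroup.center G →
      Set.centralizer ({x} : Set G) ⊆ Set.centralizer {y} →
      Set.centralizer ({x} : Set G) = Set.centralizer {y})
    (g : G) (hg : g ∉ Subgroup.center G) :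
    Nat.card {Z : Set G | (∃ x : G, x ∉ Subgroup.center G ∧
        Z = Set.centralizer (Set.centralizer {x})) ∧
        Z ⊆ Set.centralizer {g}} ≡ 1 [MOD p] ∧
    Nat.card {Z : Set G | (∃ x : G, x ∉ Subgroup.center G ∧
        Z = Set.centralizer (Set.centralizer {x})) ∧
        Z ⊆ Set.centralizer {g} ∧
        Z ≠ Set.centralizer (Set.centralizer ({g} : Set G))} ≡ 0 [MOD p] := by
  have : Fact p.Prime := ⟨hp⟩
  have h1 := card_elementCenters_modEq_one hG hF hg
  have hmem : Set.centralizer (Set.centralizer ({g} : Set G)) ∈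
      {Z : Set G | (∃ x : G, x ∉ Subgroup.center G ∧
        Z = Set.centralizer (Set.centralizer {x})) ∧ Z ⊆ Set.centralizer {g}} :=
    ⟨⟨g, hg, rfl⟩, Set.centralizer_centralizer_singleton_subset_iff.mpr
      fun z hz => by rw [Set.mem_singleton_iff.mp hz]⟩
  refine ⟨h1, Nat.ModEq.add_right_cancel' 1 ?_⟩
  rw [← Set.ncard_sdiff_singleton_add_one hmem] at h1
  convert h1 using 3
  rw [Nat.card_coe_set_eq]
  congr 1
  ext Z
  simp [and_assoc]
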